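/- arXiv:0711.2987 — 2 statements merged into one kernel-verified Lean document; each statement's English description precedes it below -/
import Mathlib

section
/- Let g ∈ Sp(2) with first row (a,b), let 0 < s̃ < 1, let x ∈ ℍ with x ≠ 0 and y ∈ Im ℍ with y ≠ 0. If both the matrix X with rows (0, −x̄), (x, 0) and the matrix Y = diag(y, x·y·x⁻¹) are horizontal at g, then a = 0 or b = 0 or D(a,b) = 0. -/
open scoped Quaternion
open Matrix

noncomputable section

/-- Real inner product on quaternions: ⟨x,y⟩ = Re(x̄·y). -/
def qip (x y : ℍ[ℝ]) : ℝ := (star x * y).re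

/-- 2×2 quaternionic matrices. -/
abbrev M2 : Type := Matrix (Fin 2) (Fin 2) ℍ[ℝ]

/-- Diagonal 2×2 matrix diag(x,y). -/
def dg (x y : ℍ[ℝ]) : M2 := !![x, 0; 0, y]

/-- Diagonal (k-)part of a 2×2 matrix. -/
def Kpart (A : M2) : M2 := dg (A 0 0) (A 1 1)

/-- Off-diagonal (p-)part of a 2×2 matrix. -/
def Ppart (A : M2) : M2 := A - Kpart A

/-- g ∈ Sp(2): g*·g = 1. -/
def Sp2 (g : M2) : Prop := gᴴ * g = 1

/-- ⟨A,B⟩ = Re trace(A*·B). -/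
def mip (A B : M2) : ℝ := ((Aᴴ * B).trace).re

/-- ⟨A,B⟩₁ = ⟨A_p,B_p⟩ + s̃·⟨A_k,B_k⟩. -/
def mip1 (s : ℝ) (A B : M2) : ℝ := mip (Ppart A) (Ppart B) + s * mip (Kpart A) (Kpart B)

/-- v_g = g⁻¹·diag(v,0)·g − diag(v,v)  (with g⁻¹ = gᴴ for g ∈ Sp(2)). -/
def vmat (g : M2) (v : ℍ[ℝ]) : M2 := gᴴ * dg v 0 * g - dg v v

/-- M is horizontal at g for the parameter s̃: ⟨M, v_g⟩₁ = 0 for all v ∈ Im ℍ. -/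
def Horizontal (s : ℝ) (g M : M2) : Prop :=
  ∀ v : ℍ[ℝ], v.re = 0 → mip1 s M (vmat g v) = 0

/-- Ad(a) : v ↦ a·v·a⁻¹ as an ℝ-linear endomorphism of ℍ. -/
def Ad (a : ℍ[ℝ]) : ℍ[ℝ] →ₗ[ℝ] ℍ[ℝ] where
  toFun v := a * v * a⁻¹
  map_add' u v := by simp [mul_add, add_mul]
  map_smul' r v := by simp [mul_smul_comm, smul_mul_assoc]

/-- D(a,b) = det(id − Ad(a⁻¹) − Ad(b⁻¹)) on ℍ. -/
def Dd (a b : ℍ[ℝ]) : ℝ := LinearMap.det (LinearMap.id - Ad a⁻¹ - Ad b⁻¹)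

theorem re_mul_comm' (p q : ℍ[ℝ]) : (p * q).re = (q * p).re := by
  simp only [Quaternion.re_mul]
  ring

/-- A quaternion orthogonal to all purely imaginary quaternions is real. -/
theorem eq_coe_re_of_forall_re_mul_eq_zero {q : ℍ[ℝ]}
    (h : ∀ v : ℍ[ℝ], v.re = 0 → (q * v).re = 0) : q = (q.re : ℍ[ℝ]) := by
  have h' : ∀ i j k : ℝ, q.imI * i + q.imJ * j + q.imK * k = 0 := fun i j k => by
    have hv := (Quaternion.re_mul q ⟨0, i, j, k⟩).symm.trans (h ⟨0, i, j, k⟩ rfl)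
    change q.re * 0 - q.imI * i - q.imJ * j - q.imK * k = 0 at hv
    linarith
  have hi := h' 1 0 0
  have hj := h' 0 1 0
  have hk := h' 0 0 1
  refine QuaternionAlgebra.ext rfl ?_ ?_ ?_ <;> simp only [Quaternion.imI_coe, Quaternion.imJ_coe,
    Quaternion.imK_coe] <;> linarith

theorem mip1_offDiag_vmat (s : ℝ) (g : M2) (x v : ℍ[ℝ]) (hv : v.re = 0) :
    mip1 s (!![0, -star x; x, 0] : M2) (vmat g v)
      = -2 * (g 0 1 * x * star (g 0 0) * v).re := by
  simp [mip1, mip, Ppart, Kpart, vmat, dg, Matrix.mul_apply, Matrix.trace, Fin.sum_univ_two,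
    Quaternion.re_mul, Quaternion.imI_mul, Quaternion.imJ_mul, Quaternion.imK_mul, hv]
  ring

theorem mip1_dg_vmat (s : ℝ) (g : M2) (y z v : ℍ[ℝ]) (hy : y.re = 0) (hz : z.re = 0)
    (hv : v.re = 0) :
    mip1 s (dg y z) (vmat g v)
      = s * ((y + z - g 0 0 * y * star (g 0 0) - g 0 1 * z * star (g 0 1)) * v).re := by
  simp [mip1, mip, Ppart, Kpart, vmat, dg, Matrix.mul_apply, Matrix.trace, Fin.sum_univ_two,
    Quaternion.re_mul, Quaternion.imI_mul, Quaternion.imJ_mul, Quaternion.imK_mul, hv, hy, hz]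
  left
  ring

theorem Sp2.first_row {g : M2} (hg : Sp2 g) :
    g 0 0 * star (g 0 0) + g 0 1 * star (g 0 1) = 1 := by
  have h : g * gᴴ = 1 := mul_eq_one_comm.mp hg
  simpa [Matrix.mul_apply, Fin.sum_univ_two] using congrFun (congrFun h 0) 0

theorem Dd_eq_zero_of_fixed {a b w : ℍ[ℝ]} (hw : w ≠ 0)
    (h : w = a⁻¹ * w * a + b⁻¹ * w * b) : Dd a b = 0 := by
  by_contra hd
  have hk := LinearMap.ker_eq_bot'.mp
    (LinearMap.equivOfDetNeZero _ hd).ker w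
  apply hw
  apply hk
  change w - a⁻¹ * w * (a⁻¹)⁻¹ - b⁻¹ * w * (b⁻¹)⁻¹ = 0
  rw [inv_inv, inv_inv, sub_sub, sub_eq_zero]
  exact h

/-- Lemma 3 of the paper (Case 2a): if a plane of type (14) is horizontal at
g ∈ Sp(2) with first row (a,b), then a = 0 or b = 0 or
det(id − Ad(a⁻¹) − Ad(b⁻¹)) = 0. -/
theorem stmt6 (s : ℝ) (hs0 : 0 < s) (hs1 : s < 1)
    (g : M2) (hg : Sp2 g)
    (x : ℍ[ℝ]) (hx : x ≠ 0) (y : ℍ[ℝ]) (hy : y.re = 0) (hy0 : y ≠ 0)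
    (hX : Horizontal s g (!![0, -star x; x, 0] : M2))
    (hY : Horizontal s g (dg y (x * y * x⁻¹))) :
    g 0 0 = 0 ∨ g 0 1 = 0 ∨ Dd (g 0 0) (g 0 1) = 0 := by
  by_cases ha : g 0 0 = 0
  · exact Or.inl ha
  by_cases hb : g 0 1 = 0
  · exact Or.inr (Or.inl hb)
  refine Or.inr (Or.inr ?_)
  have hrow := hg.first_row
  have hz : (x * y * x⁻¹).re = 0 := by
    rw [re_mul_comm', inv_mul_cancel_left₀ hx, hy]
  have hreal := eq_coe_re_of_forall_re_mul_eq_zero (q := g 0 1 * x * star (g 0 0))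
    fun v hv => by
      have := hX v hv
      rw [mip1_offDiag_vmat s g x v hv] at this
      linarith
  have hreal' := eq_coe_re_of_forall_re_mul_eq_zero
    (q := y + x * y * x⁻¹ - g 0 0 * y * star (g 0 0) - g 0 1 * (x * y * x⁻¹) * star (g 0 1))
    fun v hv => by
      have := hY v hv
      rw [mip1_dg_vmat s g y _ v hy hz hv] at this
      exact (mul_eq_zero.mp this).resolve_left hs0.ne'
  generalize g 0 0 = a at *
  generalize g 0 1 = b at *
  have hconj : ∀ c u : ℍ[ℝ], u.re = 0 → (c * u * star c).re = 0 := fun c u hu => by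
    rw [re_mul_comm', ← mul_assoc, Quaternion.star_mul_self]
    simp [Quaternion.re_mul]
    simp [hu]
  have hsum : y + x * y * x⁻¹ = a * y * star a + b * (x * y * x⁻¹) * star b := by
    have h0 : (y + x * y * x⁻¹ - a * y * star a - b * (x * y * x⁻¹) * star b).re = 0 := by
      simp only [Quaternion.re_sub, Quaternion.re_add, hconj _ _ hy, hconj _ _ hz, hy, hz]
      simp
    rw [h0, Quaternion.coe_zero, sub_sub, sub_eq_zero] at hreal'
    exact hreal'
  have hsa : star a ≠ 0 := star_ne_zero.mpr ha
  have hstar : ∀ c : ℍ[ℝ], c ≠ 0 → star c = c⁻¹ * (c * star c) := fun c hc => by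
    rw [inv_mul_cancel_left₀ hc]
  -- conjugation by `b * x` agrees with conjugation by `a`
  have hbx : b * (x * y * x⁻¹) * b⁻¹ = a * y * a⁻¹ := by
    obtain ⟨t, ht⟩ : ∃ t : ℝ, b * x = t * a := by
      refine ⟨(b * x * star a).re * (Quaternion.normSq a)⁻¹, ?_⟩
      have hN : ((Quaternion.normSq a : ℝ) : ℍ[ℝ]) ≠ 0 := by
        simpa [← Quaternion.self_mul_star] using ha
      apply mul_right_cancel₀ hsa
      rw [mul_assoc _ a, Quaternion.self_mul_star, Quaternion.coe_mul, Quaternion.coe_inv,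
        inv_mul_cancel_right₀ hN]
      exact hreal
    have ht0 : (t : ℍ[ℝ]) ≠ 0 := by
      rintro h
      rw [h, zero_mul] at ht
      exact (mul_ne_zero hb hx) ht
    calc b * (x * y * x⁻¹) * b⁻¹ = (b * x) * y * (b * x)⁻¹ := by simp only [_root_.mul_inv_rev, mul_assoc]
      _ = t * (a * y * a⁻¹) * (t : ℍ[ℝ])⁻¹ := by rw [ht]; simp only [_root_.mul_inv_rev, mul_assoc]
      _ = a * y * a⁻¹ := by rw [Quaternion.coe_commutes, mul_inv_cancel_right₀ ht0]
  have hw : y + x * y * x⁻¹ = a * y * a⁻¹ := by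
    rw [hsum, hstar a ha, hstar b hb, ← mul_assoc, ← mul_assoc (b * _), hbx, ← mul_add, hrow,
      mul_one]
  refine Dd_eq_zero_of_fixed (w := a * y * a⁻¹) (by simp [ha, hy0]) ?_
  conv_lhs => rw [← hw]
  congr 1
  · simp [mul_assoc, ha]
  · rw [← hbx]
    simp [mul_assoc, hb]

end
end

section
/- Let g ∈ Sp(2) with first row (a,b), let 0 < s̃ < 1, let y ∈ Im ℍ with y ≠ 0, let x ∈ ℍ with x ≠ 0, and let ε ∈ {1, −1} with x·y·x⁻¹ = ε•y. If the matrices Y = diag(y, ε•y) and X with rows (y, −x̄), (x, −ε•y) are both horizontal at g, then ε = −1, |a| = |b| = 1/√2, and, setting w = Im(a⁻¹·b), one has ⟨w − 2·a⁻¹·w·a, w⟩ = 0. -/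
open scoped Quaternion
open Matrix

noncomputable section

/-- The first row of a matrix in `Sp(2)` has norm one. -/
theorem Sp2.normSq_row (g : M2) (hg : Sp2 g) :
    Quaternion.normSq (g 0 0) + Quaternion.normSq (g 0 1) = 1 := by
  have h : g * gᴴ = 1 := mul_eq_one_comm.mp hg
  have h0 := congrArg (fun A : M2 => (A 0 0).re) h
  simpa [Matrix.mul_apply, Quaternion.self_mul_star, -Quaternion.re_mul] using h0

theorem normSq_eq_coords (q : ℍ[ℝ]) :
    Quaternion.normSq q = q.re ^ 2 + q.imI ^ 2 + q.imJ ^ 2 + q.imK ^ 2 :=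
  Quaternion.normSq_def' q

theorem mip1_vmat (s : ℝ) (g : M2) (p q r t v : ℍ[ℝ]) :
    mip1 s !![p, q; r, t] (vmat g v) =
      qip (g 0 1 * r * star (g 0 0)) v + qip (g 0 0 * q * star (g 0 1)) v +
      s * (qip (g 0 0 * p * star (g 0 0) + g 0 1 * t * star (g 0 1) - (p + t)) v) := by
  generalize ha : g 0 0 = a
  generalize hb : g 0 1 = b
  simp [mip1, mip, Ppart, Kpart, vmat, dg, qip, Matrix.trace, Matrix.mul_apply,
    Fin.sum_univ_two, ha, hb]
  ring

theorem qip_self (x : ℍ[ℝ]) : qip x x = Quaternion.normSq x := by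
  simp [qip, Quaternion.normSq_def']
  ring

theorem qip_neg_star (r : ℍ[ℝ]) {p : ℍ[ℝ]} (hp : p.re = 0) : qip (-star r) p = qip r p := by
  simp [qip, hp]
  ring

/-- Conjugating an imaginary quaternion gives an imaginary quaternion. -/
theorem re_conj_eq_zero (a y : ℍ[ℝ]) (hy : y.re = 0) : (a * y * star a).re = 0 := by
  simp [hy]
  ring

/-- Imaginary quaternions commuting with `y ≠ 0` are real multiples of `y`. -/
theorem exists_eq_smul_of_commute {y w : ℍ[ℝ]} (hy : y.re = 0) (hy0 : y ≠ 0) (hw : w.re = 0)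
    (h : w * y = y * w) : ∃ r : ℝ, w = r • y := by
  have hn : Quaternion.normSq y ≠ 0 := Quaternion.normSq_ne_zero.mpr hy0
  have h1 := congrArg QuaternionAlgebra.imI h
  have h2 := congrArg QuaternionAlgebra.imJ h
  have h3 := congrArg QuaternionAlgebra.imK h
  simp [hy, hw] at h1 h2 h3
  refine ⟨qip y w / Quaternion.normSq y, ?_⟩
  have key : Quaternion.normSq y • w = qip y w • y := by
    rw [normSq_eq_coords]
    ext <;> simp [qip, hy, hw]
    · linear_combination (y.imJ / 2) * h3 - (y.imK / 2) * h2
    · linear_combination (y.imK / 2) * h1 - (y.imI / 2) * h3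
    · linear_combination (y.imI / 2) * h2 - (y.imJ / 2) * h1
  rw [div_eq_inv_mul, mul_smul, ← key, smul_smul, inv_mul_cancel₀ hn, one_smul]

/-- If `diag(y, ε y)` is horizontal, then `a y ā + ε b y b̄ = (1 + ε) y`. -/
theorem Horizontal.diag_eq {s : ℝ} (hs0 : 0 < s) {g : M2} {y : ℍ[ℝ]} (hy : y.re = 0) {ε : ℝ}
    (hY : Horizontal s g (dg y (ε • y))) :
    g 0 0 * y * star (g 0 0) + g 0 1 * (ε • y) * star (g 0 1) = y + ε • y := by
  rw [← sub_eq_zero]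
  set u := g 0 0 * y * star (g 0 0) + g 0 1 * (ε • y) * star (g 0 1) - (y + ε • y) with hu
  have hεy : (ε • y).re = 0 := by simp [hy]
  have hre : u.re = 0 := by
    rw [hu, Quaternion.re_sub, Quaternion.re_add, Quaternion.re_add,
      re_conj_eq_zero _ _ hy, re_conj_eq_zero _ _ hεy, hy, hεy]
    simp
  have h := hY u hre
  rw [dg, mip1_vmat, ← hu, qip_self] at h
  simpa [qip, hs0.ne'] using h

/-- Lemma 5 of the paper (Case 2b): if a plane of type (16) is horizontal at
g ∈ Sp(2) with first row (a,b), then ε = −1, |a| = |b| = 1/√2 and, with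
w = Im(a⁻¹b), one has ⟨w − 2a⁻¹wa, w⟩ = 0. -/
theorem stmt14 (s : ℝ) (hs0 : 0 < s) (hs1 : s < 1)
    (g : M2) (hg : Sp2 g) (a b : ℍ[ℝ]) (ha : a = g 0 0) (hb : b = g 0 1)
    (y : ℍ[ℝ]) (hy : y.re = 0) (hy0 : y ≠ 0) (x : ℍ[ℝ]) (hx : x ≠ 0)
    (ε : ℝ) (hε : ε = 1 ∨ ε = -1) (hxy : x * y * x⁻¹ = ε • y)
    (hY : Horizontal s g (dg y (ε • y)))
    (hX : Horizontal s g (!![y, -star x; x, -(ε • y)] : M2)) :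
    ε = -1 ∧ ‖a‖ = 1 / Real.sqrt 2 ∧ ‖b‖ = 1 / Real.sqrt 2 ∧
      qip ((a⁻¹ * b).im - 2 * (a⁻¹ * (a⁻¹ * b).im * a)) (a⁻¹ * b).im = 0 := by
  have hrow := Sp2.normSq_row g hg
  have hYeq := hY.diag_eq hs0 hy
  rw [← ha, ← hb] at hrow hYeq
  have hny : 0 < ‖y‖ := norm_pos_iff.mpr hy0
  have hrow' : ‖a‖ * ‖a‖ + ‖b‖ * ‖b‖ = 1 := by
    simpa [Quaternion.normSq_eq_norm_mul_self] using hrow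
  have hε' : ε = -1 := by
    refine hε.resolve_left fun h => ?_
    subst h
    have hn := norm_add_le (a * y * star a) (b * ((1 : ℝ) • y) * star b)
    rw [hYeq, one_smul, ← two_smul ℝ y, norm_smul] at hn
    simp only [norm_mul, norm_star] at hn
    norm_num at hn
    nlinarith
  subst hε'
  have hab : a * y * star a = b * y * star b := by
    simpa [← sub_eq_add_neg, sub_eq_zero] using hYeq
  have hnab : ‖a‖ * ‖a‖ = ‖b‖ * ‖b‖ := by
    have hn := congrArg norm hab
    simp only [norm_mul, norm_star] at hn
    exact mul_right_cancel₀ hny.ne' (by linarith)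
  have hna : ‖a‖ = 1 / √2 := by
    rw [← Real.sqrt_one, ← Real.sqrt_div zero_le_one, eq_comm,
      Real.sqrt_eq_iff_mul_self_eq (by norm_num) (norm_nonneg _)]
    linarith
  have hnb : ‖b‖ = 1 / √2 := by
    rw [← hna]
    exact ((mul_self_inj (norm_nonneg a) (norm_nonneg b)).mp hnab).symm
  refine ⟨rfl, hna, hnb, ?_⟩
  have hNa : Quaternion.normSq a = 1 / 2 := by
    rw [Quaternion.normSq_eq_norm_mul_self]; linarith
  have hNb : Quaternion.normSq b = 1 / 2 := by
    rw [Quaternion.normSq_eq_norm_mul_self]; linarith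
  have haa : star a * a = ((1 / 2 : ℝ) : ℍ[ℝ]) := by rw [Quaternion.star_mul_self, hNa]
  have hbb : star b * b = ((1 / 2 : ℝ) : ℍ[ℝ]) := by rw [Quaternion.star_mul_self, hNb]
  have hinv : a⁻¹ = (2 : ℝ) • star a := by
    rw [Quaternion.inv_def, hNa]; norm_num
  have hcomm : star a * b * y = y * (star a * b) := by
    have h1 : star a * (a * y * star a) * b = star a * (b * y * star b) * b := by rw [hab]
    have h2 : (star a * a) * y * (star a * b) = star a * b * y * (star b * b) := by
      simpa only [mul_assoc] using h1
    rw [haa, hbb, Quaternion.coe_mul_eq_smul, Quaternion.mul_coe_eq_smul, smul_mul_assoc] at h2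
    exact (smul_right_injective _ (by norm_num : (1 / 2 : ℝ) ≠ 0) h2).symm
  have hxy' : x * y = -(y * x) := by
    rw [mul_inv_eq_iff_eq_mul₀ hx] at hxy
    simpa using hxy
  have hsy : star y = -y := by
    ext <;> simp [hy]
  have hx0 : qip (b * x * star a) (a * y * star a) = 0 := by
    have e1 : qip (b * x * star a) (a * y * star a) =
        Quaternion.normSq a * (star x * (star b * a) * y).re := by
      rw [normSq_eq_coords]
      simp [qip]
      ring
    have hc : star b * a * y = y * (star b * a) := by
      have h := congrArg star hcomm
      simp only [star_mul, star_star, hsy] at h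
      simpa using h.symm
    have hx' : star x * y = -(y * star x) := by
      have h := congrArg star hxy'
      simp only [star_mul, star_neg, hsy] at h
      simp at h
      rw [← h]
    have e2 : star x * (star b * a) * y = -(y * (star x * (star b * a))) := by
      rw [mul_assoc, hc, ← mul_assoc, hx']; simp [mul_assoc]
    have e3 (p q : ℍ[ℝ]) : (p * q).re = (q * p).re := by simp; ring
    have e4 := congrArg QuaternionAlgebra.re e2
    rw [Quaternion.re_neg, e3 y] at e4
    rw [e1]
    have : (star x * (star b * a) * y).re = 0 := by linarith
    rw [this, mul_zero]
  have hP : qip y (a * y * star a) = Quaternion.normSq y / 4 := by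
    have h := hX _ (re_conj_eq_zero a y hy)
    rw [mip1_vmat, ← ha, ← hb] at h
    have e1 : qip (a * -star x * star b) (a * y * star a) =
        qip (b * x * star a) (a * y * star a) := by
      have : a * -star x * star b = -star (b * x * star a) := by simp [mul_assoc]
      rw [this, qip_neg_star _ (re_conj_eq_zero a y hy)]
    rw [e1, hx0, neg_smul, one_smul, neg_neg, ← hab] at h
    have h' : qip (a * y * star a + a * y * star a - (y + y)) (a * y * star a) = 0 := by
      simpa [hs0.ne'] using h
    have e2 (p : ℍ[ℝ]) : qip (p + p - (y + y)) p = 2 * (qip p p - qip y p) := by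
      simp [qip]; ring
    rw [e2, qip_self, map_mul, map_mul, Quaternion.normSq_star, hNa] at h'
    linarith
  have hw : (a⁻¹ * b).im * y = y * (a⁻¹ * b).im := by
    have h : a⁻¹ * b * y = y * (a⁻¹ * b) := by
      rw [hinv, smul_mul_assoc, smul_mul_assoc, hcomm, mul_smul_comm]
    rw [← Quaternion.sub_re_self, sub_mul, mul_sub, h, Quaternion.coe_commutes]
  obtain ⟨r, hr⟩ := exists_eq_smul_of_commute hy hy0 (by simp) hw
  rw [hr, hinv, two_mul]
  have e : qip (r • y - ((2 : ℝ) • star a * r • y * a + (2 : ℝ) • star a * r • y * a)) (r • y) =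
      r ^ 2 * (Quaternion.normSq y - 4 * qip y (a * y * star a)) := by
    rw [normSq_eq_coords]
    simp [qip, hy]
    ring
  rw [e, hP]
  ring

end
end
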